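/- Let X be an n×n quaternion matrix. Then the quadratic form xᴴXx is a real number (has zero imaginary part) for every x ∈ ℍⁿ if and only if X is Hermitian, i.e., X = Xᴴ. -/

import Mathlib

open Matrix Quaternion BigOperators

/-- A quaternion `a` with `a * q = star q * a` for every `q` vanishes. -/
lemma Quaternion.eq_zero_of_forall_mul_eq_star_mul {a : ℍ[ℝ]}
    (h : ∀ q : ℍ[ℝ], a * q = star q * a) : a = 0 := by
  obtain ⟨p, q, hpq⟩ : ∃ p q : ℍ[ℝ], p * q - q * p ≠ 0 := by
    let i : ℍ[ℝ] := ⟨0, 1, 0, 0⟩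
    let j : ℍ[ℝ] := ⟨0, 0, 1, 0⟩
    refine ⟨i, j, fun hij => ?_⟩
    have hk := congrArg (fun z : ℍ[ℝ] => z.imK) hij
    simp only [Quaternion.imK_sub, Quaternion.imK_mul, Quaternion.imK_zero] at hk
    norm_num [i, j] at hk
  have hcomm : a * (p * q) = a * (q * p) := by
    rw [← mul_assoc, h p, mul_assoc, h q, ← mul_assoc, ← star_mul, ← h]
  refine (mul_eq_zero.mp ?_).resolve_right hpq
  rw [mul_sub, hcomm, sub_self]

/-- Conjugating the quadratic form of a matrix gives that of its conjugate transpose. -/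
lemma Matrix.star_star_dotProduct_mulVec {ι R : Type*} [Fintype ι] [Ring R] [StarRing R]
    (A : Matrix ι ι R) (x : ι → R) :
    star (star x ⬝ᵥ A *ᵥ x) = star x ⬝ᵥ Aᴴ *ᵥ x := by
  rw [dotProduct_mulVec, ← star_dotProduct_star, star_vecMul, star_star]

/-- A quaternion matrix whose quadratic form vanishes identically is zero. -/
lemma Matrix.eq_zero_of_forall_star_dotProduct_mulVec_eq_zero {ι : Type*} [Fintype ι]
    {A : Matrix ι ι ℍ[ℝ]} (h : ∀ x : ι → ℍ[ℝ], star x ⬝ᵥ A *ᵥ x = 0) : A = 0 := by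
  classical
  have polar (i j : ι) (q : ℍ[ℝ]) : A i j * q + star q * A j i = 0 := by
    have hij := h (Pi.single i 1 + Pi.single j q)
    rw [star_add, mulVec_add, add_dotProduct, dotProduct_add, dotProduct_add, h, h, zero_add,
      add_zero] at hij
    simpa [← Pi.single_star] using hij
  ext1 i j
  refine Quaternion.eq_zero_of_forall_mul_eq_star_mul fun q => ?_
  have hji : A j i = -A i j := by
    simpa using eq_neg_of_add_eq_zero_right (polar i j 1)
  rw [eq_neg_of_add_eq_zero_left (polar i j q), hji, mul_neg, neg_neg]

/-- The quadratic form `xᴴ X x` of a quaternion matrix is a real number (zero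
imaginary part) for every quaternion vector `x` if and only if `X` is
Hermitian, i.e. `X = Xᴴ`. -/
theorem quadratic_form_real_iff_hermitian {n : ℕ}
    (X : Matrix (Fin n) (Fin n) ℍ[ℝ]) :
    (∀ x : Fin n → ℍ[ℝ],
        star x ⬝ᵥ X.mulVec x = (((star x ⬝ᵥ X.mulVec x).re : ℝ) : ℍ[ℝ]))
      ↔ X = Xᴴ := by
  simp only [← Quaternion.star_eq_self, Matrix.star_star_dotProduct_mulVec]
  refine ⟨fun h => ?_, fun h x => by rw [← h]⟩
  refine sub_eq_zero.mp (Matrix.eq_zero_of_forall_star_dotProduct_mulVec_eq_zero fun x => ?_)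
  rw [sub_mulVec, dotProduct_sub, h, sub_self]
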